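/- Fix q ∈ ℝ with 0 < q < 1/2 and let a(Δ) := (Q(q)^Δ)_{1,0}. Then the Whittle index W(H) := (H(a(H−1)−a(H)) + a(H)) / ((H−1)(a(H−1)−a(H)) + a(H) + q) satisfies W(H) < 1/(1+2q) for every integer H ≥ 1, and W(H) → 1/(1+2q) as H → ∞. -/

import Mathlib

open Matrix Filter

/-- The one-step transition matrix of a symmetric two-state Markov chain
with switching probability `q`. -/
def Qmat (q : ℝ) : Matrix (Fin 2) (Fin 2) ℝ := !![1 - q, q; q, 1 - q]

/-- `a q Δ` is the `(1,0)` entry of the `Δ`-th power of `Qmat q`. -/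
def a (q : ℝ) (Δ : ℕ) : ℝ := (Qmat q ^ Δ) 1 0

/-- The Whittle index in state `(X̂ = 1, AoI = H)`. -/
noncomputable def W (q : ℝ) (H : ℕ) : ℝ :=
  ((H : ℝ) * (a q (H - 1) - a q H) + a q H) /
    (((H : ℝ) - 1) * (a q (H - 1) - a q H) + a q H + q)

theorem Qmat_pow (q : ℝ) (n : ℕ) :
    Qmat q ^ n = !![(1 + (1 - 2 * q) ^ n) / 2, (1 - (1 - 2 * q) ^ n) / 2;
      (1 - (1 - 2 * q) ^ n) / 2, (1 + (1 - 2 * q) ^ n) / 2] := by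
  induction n with
  | zero => ext i j; fin_cases i <;> fin_cases j <;> simp
  | succ n ih =>
    rw [pow_succ, ih, Qmat]
    ext i j
    fin_cases i <;> fin_cases j <;> simp [Matrix.mul_apply, Fin.sum_univ_two] <;> ring

theorem a_eq (q : ℝ) (n : ℕ) : a q n = (1 - (1 - 2 * q) ^ n) / 2 := by
  simp [a, Qmat_pow]

theorem W_succ (q : ℝ) (n : ℕ) :
    W q (n + 1) =
      (1 / 2 - q * (n * (1 - 2 * q) ^ n) - (1 - 2 * q) ^ n / 2) /
        (1 / 2 + q - q * (n * (1 - 2 * q) ^ n) - (1 - 2 * q) / 2 * (1 - 2 * q) ^ n) := by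
  rw [W, Nat.add_sub_cancel, a_eq, a_eq]
  push_cast
  congr 1 <;> ring

theorem one_add_mul_mul_pow_le_one {q : ℝ} (hq0 : 0 < q) (hq1 : q < 1 / 2) (n : ℕ) :
    (1 + 2 * q * n) * (1 - 2 * q) ^ n ≤ 1 := by
  induction n with
  | zero => simp
  | succ n ih =>
    have hr : 0 ≤ (1 - 2 * q) ^ n := pow_nonneg (by linarith) n
    have h : 0 ≤ 4 * q ^ 2 * (n + 1) * (1 - 2 * q) ^ n := by positivity
    rw [pow_succ]
    push_cast
    linarith

theorem stmt_12 (q : ℝ) (hq0 : 0 < q) (hq1 : q < 1/2) :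
    (∀ H : ℕ, 1 ≤ H → W q H < 1 / (1 + 2*q)) ∧
    Tendsto (fun H : ℕ => W q H) atTop (nhds (1 / (1 + 2*q))) := by
  constructor
  · intro H hH
    obtain ⟨n, rfl⟩ := Nat.exists_eq_add_of_le' hH
    have hr : 0 < (1 - 2 * q) ^ n := pow_pos (by linarith) n
    have hb := one_add_mul_mul_pow_le_one hq0 hq1 n
    have hqr : 0 < q * (1 - 2 * q) ^ n := by positivity
    have hqq : 0 < q * (q * (n + 1) * (1 - 2 * q) ^ n) := by positivity
    have hqqr : 0 < q * (1 - q) * (1 - 2 * q) ^ n :=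
      mul_pos (mul_pos hq0 (by linarith)) hr
    rw [W_succ, div_lt_div_iff₀ (by linarith) (by linarith)]
    linarith
  · rw [← tendsto_add_atTop_iff_nat 1]
    simp only [W_succ]
    have hp := tendsto_pow_atTop_nhds_zero_of_lt_one (r := 1 - 2 * q) (by linarith) (by linarith)
    have hm := tendsto_self_mul_const_pow_of_lt_one (r := 1 - 2 * q) (by linarith) (by linarith)
    have hnum := ((hm.const_mul q).const_sub (1 / 2)).sub (hp.div_const 2)
    have hden := ((hm.const_mul q).const_sub (1 / 2 + q)).sub (hp.const_mul ((1 - 2 * q) / 2))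
    have hlim : 1 / (1 + 2 * q) =
        (1 / 2 - q * 0 - 0 / 2) / (1 / 2 + q - q * 0 - (1 - 2 * q) / 2 * 0) := by
      rw [div_eq_div_iff (by linarith) (by linarith)]
      ring
    rw [hlim]
    exact hnum.div hden (by linarith)
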